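/- arXiv:2510.18698 — 4 statements merged into one kernel-verified Lean document; each statement's English description precedes it below -/
import Mathlib

section
/- Assume T_{−y}∘L̲₊[e_{ζ,−μ}] = L̲₊∘T_{−y}[e_{ζ,−μ}] for all (y,μ,ζ) ∈ ℝ₊×ℝ₊×Y₊ with L̲₊[e_{1̌,−μ}](·,0) ∈ Y₊. If c*₋(L̲₊) := inf_{μ∈I⁻} (1/μ) log λ̲(μ) < 0, then for any ε ∈ (0, −c*₋(L̲₊)) there exists μ = μ_ε > 0 such that: (i) λ̲(μ) < e^{(c*₋(L̲₊)+ε)μ} < 1; (ii) L̲₊[e_{ζ̲_μ,−μ}] ≤ e^{(c*₋(L̲₊)+ε)μ} e_{ζ̲_μ,−μ}, and consequently L̲₊ⁿ[e_{ζ̲_μ,−μ}](θ,x) ≤ e^{[x+n(c*₋(L̲₊)+ε)]μ} ζ̲_μ(θ) for all n ∈ ℕ, θ ∈ M, x ∈ ℝ. (Lemma 2.1) -/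
open Filter Topology

noncomputable section

/-- The Euclidean norm on `ℝ^N`. -/
def eNorm {N : ℕ} (a : Fin N → ℝ) : ℝ := Real.sqrt (∑ i, (a i) ^ 2)

/-- Elements of `C = C(M, BC(ℝ, ℝ^N))`, identified with (bounded continuous)
functions on `M × ℝ` with values in `ℝ^N`. -/
abbrev Cfun (M : Type*) (N : ℕ) := M × ℝ → Fin N → ℝ

/-- The sup-norm of `Y = C(M, ℝ^N)`. -/
def normY {M : Type*} {N : ℕ} (g : M → Fin N → ℝ) : ℝ := ⨆ θ : M, eNorm (g θ)

/-- The norm of `X = BC(ℝ, ℝ^N)`:  `∑ₙ 2⁻ⁿ sup_{|x| ≤ n} ‖ψ(x)‖`. -/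
def normX {N : ℕ} (ψ : ℝ → Fin N → ℝ) : ℝ :=
  ∑' n : ℕ, (2 : ℝ)⁻¹ ^ (n + 1) * ⨆ x : {x : ℝ // |x| ≤ (n : ℝ) + 1}, eNorm (ψ x.1)

/-- The norm of `C = C(M, X)`. -/
def normC {M : Type*} {N : ℕ} (φ : Cfun M N) : ℝ := ⨆ θ : M, normX (fun x => φ (θ, x))

/-- Pointwise (coordinatewise) order on `C`. -/
def funLE {M : Type*} {N : ℕ} (φ ψ : Cfun M N) : Prop := ∀ p i, φ p i ≤ ψ p i

/-- Membership in `C₊`: bounded, continuous and nonnegative. -/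
def inCplus {M : Type*} {N : ℕ} [TopologicalSpace M] (φ : Cfun M N) : Prop :=
  Continuous φ ∧ (∃ B, ∀ p i, |φ p i| ≤ B) ∧ ∀ p i, 0 ≤ φ p i

/-- Membership in `Y₊ = C(M, ℝ₊^N)`. -/
def inYplus {M : Type*} {N : ℕ} [TopologicalSpace M] (g : M → Fin N → ℝ) : Prop :=
  Continuous g ∧ ∀ θ i, 0 ≤ g θ i

/-- Membership in `Int(Y₊)`. -/
def inIntYplus {M : Type*} {N : ℕ} [TopologicalSpace M] (g : M → Fin N → ℝ) : Prop :=
  Continuous g ∧ ∀ θ i, 0 < g θ i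

/-- A `Y`-element viewed as an `x`-independent element of `C`. -/
def ofY {M : Type*} {N : ℕ} (g : M → Fin N → ℝ) : Cfun M N := fun p => g p.1

/-- `C_r = {φ ∈ C : 0 ≤ φ ≤ r}` for `r ∈ Y₊`. -/
def inCr {M : Type*} {N : ℕ} [TopologicalSpace M] (r : M → Fin N → ℝ) (φ : Cfun M N) : Prop :=
  inCplus φ ∧ funLE φ (ofY r)

/-- The translation operator `T_y`. -/
def Ty {M : Type*} {N : ℕ} (y : ℝ) (φ : Cfun M N) : Cfun M N := fun p => φ (p.1, p.2 - y)

/-- `Q` maps `C₊` into `C₊`. -/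
def mapsCplus {M : Type*} {N : ℕ} [TopologicalSpace M] (Q : Cfun M N → Cfun M N) : Prop :=
  ∀ φ, inCplus φ → inCplus (Q φ)

/-- Continuity of `Q : C₊ → C₊`: the restriction of `Q` to each `C_r`
(`r` a constant positive vector) is continuous for the metric of `‖·‖_C`. -/
def QContinuous {M : Type*} {N : ℕ} [TopologicalSpace M] (Q : Cfun M N → Cfun M N) : Prop :=
  ∀ r : Fin N → ℝ, (∀ i, 0 < r i) → ∀ φ, inCr (fun _ => r) φ → ∀ ε > (0 : ℝ), ∃ δ > (0 : ℝ),
    ∀ ψ, inCr (fun _ => r) ψ → normC (fun p i => ψ p i - φ p i) < δ →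
      normC (fun p i => Q ψ p i - Q φ p i) < ε

/-- Monotonicity (order preservation) of `Q` on `C₊`. -/
def QMonotone {M : Type*} {N : ℕ} [TopologicalSpace M] (Q : Cfun M N → Cfun M N) : Prop :=
  ∀ φ ψ, inCplus φ → inCplus ψ → funLE φ ψ → funLE (Q φ) (Q ψ)

/-- Assumption (A): `Q₊` is a continuous limiting map with fixed point `r* ∈ Int(Y₊)`
and `T_{-y} ∘ Qⁿ ∘ T_y [φ] → Q₊ⁿ[φ]` in `C` as `y → ∞`. -/
def AssumptionA {M : Type*} {N : ℕ} [TopologicalSpace M] (Q Qplus : Cfun M N → Cfun M N)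
    (rstar : M → Fin N → ℝ) : Prop :=
  inIntYplus rstar ∧ mapsCplus Qplus ∧ QContinuous Qplus ∧ Qplus (ofY rstar) = ofY rstar ∧
    ∀ φ, inCplus φ → ∀ n : ℕ,
      Tendsto (fun y : ℝ =>
        normC (fun p i => Ty (-y) (Q^[n] (Ty y φ)) p i - Qplus^[n] φ p i)) atTop (nhds 0)

/-- Assumption (UB) for the exhausting sequence `φk`. -/
def AssumptionUB {M : Type*} {N : ℕ} [TopologicalSpace M] (Q : Cfun M N → Cfun M N)
    (φk : ℕ → M → Fin N → ℝ) : Prop :=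
  (∀ k, inIntYplus (φk k)) ∧
  (∀ k, funLE (ofY (φk k)) (ofY (φk (k + 1))) ∧ φk k ≠ φk (k + 1)) ∧
  (∀ g : M → Fin N → ℝ, inYplus g → ∃ k, ∀ θ i, g θ i ≤ φk k θ i) ∧
  (∀ k φ, inCr (φk k) φ → inCr (φk k) (Q φ))

/-- Assumption (SP): strong positivity. -/
def AssumptionSP {M : Type*} {N : ℕ} [TopologicalSpace M] (Q : Cfun M N → Cfun M N) : Prop :=
  ∃ (ρ ϱ : ℝ) (Nstar : ℕ), 0 < ρ ∧ ρ < ϱ ∧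
    ∀ (a : ℝ) (φ : Cfun M N), inCplus φ → φ ≠ 0 → (fun θ => φ (θ, a)) ≠ 0 →
      ∀ n, Nstar ≤ n → ∀ x ∈ Set.Icc (a + n * ρ) (a + n * ϱ), ∀ θ i, 0 < Q^[n] φ (θ, x) i

/-- Assumption (UC) for `Q₊` with leftward/rightward speeds `cm = c₋*`, `cp = c₊*`. -/
def AssumptionUC {M : Type*} {N : ℕ} [TopologicalSpace M] (Qplus : Cfun M N → Cfun M N)
    (rstar : M → Fin N → ℝ) (cm cp : ℝ) : Prop :=
  0 < cp + cm ∧ ∀ ε : ℝ, 0 < ε → ε < (cp + cm) / 2 → ∀ φ : Cfun M N, inCplus φ → φ ≠ 0 →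
    Tendsto (fun n : ℕ =>
      sSup {v : ℝ | ∃ x ∈ Set.Icc ((n : ℝ) * (-cm + ε)) ((n : ℝ) * (cp - ε)),
        v = normY (fun θ i => Qplus^[n] φ (θ, x) i - rstar θ i)}) atTop (nhds 0)

/-- Assumption (GUAA₋): generalized uniform asymptotic annihilation at `-∞`. -/
def AssumptionGUAAm {M : Type*} {N : ℕ} [TopologicalSpace M]
    (Q : Cfun M N → Cfun M N) : Prop :=
  ∃ (rss : ℕ → M → Fin N → ℝ) (Qh Qhp : ℕ → Cfun M N → Cfun M N),
    (∀ l, inIntYplus (rss l)) ∧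
    (∀ φ, inCplus φ → ∃ l, funLE φ (ofY (rss l))) ∧
    (∀ l φ ψ, inCplus φ → inCplus ψ → funLE φ ψ → funLE ψ (ofY (rss l)) →
      funLE (Q φ) (Qh l φ) ∧ funLE (Qh l φ) (Qh l ψ) ∧
        funLE (Qh l ψ) (Qh l (ofY (rss l))) ∧ funLE (Qh l (ofY (rss l))) (ofY (rss l))) ∧
    (∀ l, Tendsto (fun n : ℕ =>
        normY (fun θ => (Qhp l)^[n] (ofY (rss l)) (θ, 0))) atTop (nhds 0)) ∧
    (∀ l (n : ℕ) (i : Fin N), 0 ≤ Filter.liminf (fun y : ℝ =>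
        ⨅ θ, ((Qhp l)^[n] (ofY (rss l)) (θ, 0) i
          - Ty (-y) ((Qh l)^[n] (Ty y (ofY (rss l)))) (θ, 0) i)) atBot)

/-- Membership in `C̃`: finite sums of functions `e_{φ,μ}(θ,x) = φ(θ,x)e^{−μx}`
with `φ` bounded. -/
def inCtilde {M : Type*} {N : ℕ} (φ : Cfun M N) : Prop :=
  ∃ (l : ℕ) (g : Fin l → Cfun M N) (μ : Fin l → ℝ),
    (∀ j, ∃ B, ∀ p i, |g j p i| ≤ B) ∧
    φ = fun p i => ∑ j, g j p i * Real.exp (-(μ j) * p.2)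

/-- `e_{φ,μ}(θ,x) = φ(θ,x) e^{−μx}`; in particular `efun (ofY ζ) (-μ) = e_{ζ,−μ}`. -/
def efun {M : Type*} {N : ℕ} (φ : Cfun M N) (μ : ℝ) : Cfun M N :=
  fun p i => φ p i * Real.exp (-μ * p.2)

/-- The constant function `1̌ = (1,…,1)`. -/
def oneC (M : Type*) (N : ℕ) : Cfun M N := fun _ _ => 1

/-- `μ ∈ I⁻ = {μ > 0 : L̲₊[e_{1̌,−μ}](·,0) ∈ Y₊}`. -/
def inILm {M : Type*} {N : ℕ} (Lp : Cfun M N → Cfun M N) (μ : ℝ) : Prop :=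
  0 < μ ∧ ∀ θ i, 0 ≤ Lp (efun (oneC M N) (-μ)) (θ, 0) i

/-- A monotone linear operator on `C̃` (with the pointwise ordering). -/
def LinearMonotoneOnCtilde {M : Type*} {N : ℕ} (L : Cfun M N → Cfun M N) : Prop :=
  (∀ φ, inCtilde φ → inCtilde (L φ)) ∧
  (∀ φ ψ, inCtilde φ → inCtilde ψ →
      L (fun p i => φ p i + ψ p i) = fun p i => L φ p i + L ψ p i) ∧
  (∀ (a : ℝ) (φ : Cfun M N), inCtilde φ → L (fun p i => a * φ p i) = fun p i => a * L φ p i) ∧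
  (∀ φ ψ, inCtilde φ → inCtilde ψ → funLE φ ψ → funLE (L φ) (L ψ))

/-- The eigenvalue data of `L̲₊`: for each `μ ∈ I⁻`, `λ̲(μ)` is the principal eigenvalue
of `L̲₊,μ` on `Y`, with unique strongly positive eigenfunction `ζ̲_μ` normalized by
`inf{ζ̲_μ^i(θ)} = 1`. -/
def EigenData {M : Type*} {N : ℕ} [TopologicalSpace M] (Lp : Cfun M N → Cfun M N)
    (lam : ℝ → ℝ) (ζ : ℝ → M → Fin N → ℝ) : Prop :=
  ∀ μ, inILm Lp μ →
    (∀ θ i, Lp (efun (ofY (ζ μ)) (-μ)) (θ, 0) i = lam μ * ζ μ θ i) ∧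
    Continuous (ζ μ) ∧ (∀ θ i, 0 < ζ μ θ i) ∧
    sInf {v : ℝ | ∃ θ i, v = ζ μ θ i} = 1

/-- The translation commutation hypothesis of Lemma 2.1:
`T_{−y}∘L̲₊[e_{ζ,−μ}] = L̲₊∘T_{−y}[e_{ζ,−μ}]` for all `(y,μ,ζ) ∈ ℝ₊×ℝ₊×Y₊` with
`L̲₊[e_{1̌,−μ}](·,0) ∈ Y₊`. -/
def CommutesWithTranslations {M : Type*} {N : ℕ} [TopologicalSpace M]
    (Lp : Cfun M N → Cfun M N) : Prop :=
  ∀ (y μ : ℝ) (ζ : M → Fin N → ℝ), 0 ≤ y → 0 ≤ μ → inYplus ζ →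
    (∀ θ i, 0 ≤ Lp (efun (oneC M N) (-μ)) (θ, 0) i) →
    Ty (-y) (Lp (efun (ofY ζ) (-μ))) = Lp (Ty (-y) (efun (ofY ζ) (-μ)))

theorem inCtilde_const_mul {M : Type*} {N : ℕ} {φ : Cfun M N} (a : ℝ) (hφ : inCtilde φ) :
    inCtilde (fun p i => a * φ p i) := by
  obtain ⟨l, g, μ, hg, rfl⟩ := hφ
  refine ⟨l, fun j p i => a * g j p i, μ, fun j => ?_, ?_⟩
  · obtain ⟨B, hB⟩ := hg j
    refine ⟨|a| * B, fun p i => ?_⟩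
    rw [abs_mul]
    exact mul_le_mul_of_nonneg_left (hB p i) (abs_nonneg a)
  · funext p i
    simp only [Finset.mul_sum, mul_assoc]

theorem inCtilde_efun_ofY {M : Type*} {N : ℕ} [TopologicalSpace M] [CompactSpace M]
    {g : M → Fin N → ℝ} (hg : Continuous g) (μ : ℝ) : inCtilde (efun (ofY g) μ) := by
  refine ⟨1, fun _ => ofY g, fun _ => μ, fun _ => ?_, ?_⟩
  · obtain ⟨B, hB⟩ := isCompact_univ.exists_bound_of_continuousOn hg.continuousOn
    exact ⟨B, fun p i => (norm_le_pi_norm (g p.1) i).trans (hB p.1 (Set.mem_univ _))⟩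
  · funext p i
    simp [efun]

theorem Ty_neg_efun_ofY {M : Type*} {N : ℕ} (g : M → Fin N → ℝ) (μ y : ℝ) :
    Ty (-y) (efun (ofY g) (-μ)) = fun p i => Real.exp (μ * y) * efun (ofY g) (-μ) p i := by
  funext p i
  have h : Real.exp (- -μ * (p.2 - -y)) = Real.exp (μ * y) * Real.exp (- -μ * p.2) := by
    rw [← Real.exp_add]
    ring_nf
  simp only [Ty, efun, ofY, h]
  ring

/-- A translation-invariant linear operator maps `e_{g,−μ}` to an exponential in `x`. -/
theorem apply_efun_ofY_eq {M : Type*} {N : ℕ} [TopologicalSpace M] [CompactSpace M]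
    {Lp : Cfun M N → Cfun M N} (hlin : LinearMonotoneOnCtilde Lp)
    (hcomm : CommutesWithTranslations Lp) {μ : ℝ} (hμ : inILm Lp μ)
    {g : M → Fin N → ℝ} (hg : inYplus g) (θ : M) (x : ℝ) (i : Fin N) :
    Lp (efun (ofY g) (-μ)) (θ, x) i
      = Real.exp (μ * x) * Lp (efun (ofY g) (-μ)) (θ, 0) i := by
  have key : ∀ y, 0 ≤ y → ∀ x, Lp (efun (ofY g) (-μ)) (θ, x + y) i
      = Real.exp (μ * y) * Lp (efun (ofY g) (-μ)) (θ, x) i := by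
    intro y hy x
    have h := hcomm y μ g hy hμ.1.le hg hμ.2
    rw [Ty_neg_efun_ofY, hlin.2.2.1 _ _ (inCtilde_efun_ofY hg.1 _)] at h
    simpa [Ty] using congrFun (congrFun h (θ, x)) i
  rcases le_total 0 x with hx | hx
  · simpa using key x hx 0
  · have h := key (-x) (neg_nonneg.mpr hx) x
    rw [add_neg_cancel] at h
    rw [h, ← mul_assoc, ← Real.exp_add]
    simp

/-- A supersolution inequality `L φ ≤ k φ` with `k ≥ 0` iterates to `Lⁿ φ ≤ kⁿ φ`. -/
theorem iterate_le_of_apply_le {M : Type*} {N : ℕ} {L : Cfun M N → Cfun M N}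
    (hlin : LinearMonotoneOnCtilde L) {φ : Cfun M N} (hφ : inCtilde φ) {k : ℝ} (hk : 0 ≤ k)
    (h : funLE (L φ) (fun p i => k * φ p i)) (n : ℕ) :
    inCtilde (L^[n] φ) ∧ funLE (L^[n] φ) (fun p i => k ^ n * φ p i) := by
  induction n with
  | zero => exact ⟨hφ, fun p i => by simp⟩
  | succ n ih =>
    rw [Function.iterate_succ_apply']
    refine ⟨hlin.1 _ ih.1, fun p i => ?_⟩
    have hmono := hlin.2.2.2 _ _ ih.1 (inCtilde_const_mul (k ^ n) hφ) ih.2 p i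
    rw [hlin.2.2.1 _ _ hφ] at hmono
    calc L (L^[n] φ) p i ≤ k ^ n * L φ p i := hmono
      _ ≤ k ^ n * (k * φ p i) := mul_le_mul_of_nonneg_left (h p i) (pow_nonneg hk n)
      _ = k ^ (n + 1) * φ p i := by ring

/-- Lemma 2.1: if `c*₋(L̲₊) = inf_{μ∈I⁻} (1/μ) log λ̲(μ) < 0`, then for any
`ε ∈ (0, −c*₋(L̲₊))` there exists `μ = μ_ε > 0` (in `I⁻`) such that
(i) `λ̲(μ) < e^{(c*₋+ε)μ} < 1`, and
(ii) `L̲₊[e_{ζ̲_μ,−μ}] ≤ e^{(c*₋+ε)μ} e_{ζ̲_μ,−μ}`, and consequently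
`L̲₊ⁿ[e_{ζ̲_μ,−μ}](θ,x) ≤ e^{(x+n(c*₋+ε))μ} ζ̲_μ(θ)` for all `n, θ, x`. -/
theorem lem2_1 {M : Type*} {N : ℕ} [MetricSpace M] [CompactSpace M]
    (Lp : Cfun M N → Cfun M N) (lam : ℝ → ℝ) (ζ : ℝ → M → Fin N → ℝ) (cstarm : ℝ)
    (hlin : LinearMonotoneOnCtilde Lp)
    (hcomm : CommutesWithTranslations Lp)
    (heig : EigenData Lp lam ζ)
    (hc : cstarm = sInf {v : ℝ | ∃ μ, inILm Lp μ ∧ v = μ⁻¹ * Real.log (lam μ)})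
    (hcneg : cstarm < 0) :
    ∀ ε : ℝ, 0 < ε → ε < -cstarm →
      ∃ μ : ℝ, 0 < μ ∧ inILm Lp μ ∧
        (lam μ < Real.exp ((cstarm + ε) * μ) ∧ Real.exp ((cstarm + ε) * μ) < 1) ∧
        funLE (Lp (efun (ofY (ζ μ)) (-μ)))
          (fun p i => Real.exp ((cstarm + ε) * μ) * efun (ofY (ζ μ)) (-μ) p i) ∧
        ∀ (n : ℕ) (θ : M) (x : ℝ) (i : Fin N),
          Lp^[n] (efun (ofY (ζ μ)) (-μ)) (θ, x) i
            ≤ Real.exp ((x + n * (cstarm + ε)) * μ) * ζ μ θ i := by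
  intro ε hε hεc
  have hne : {v : ℝ | ∃ μ, inILm Lp μ ∧ v = μ⁻¹ * Real.log (lam μ)}.Nonempty := by
    by_contra hempty
    rw [Set.not_nonempty_iff_eq_empty.mp hempty, Real.sInf_empty] at hc
    exact hcneg.ne hc
  obtain ⟨v, ⟨μ, hμ, rfl⟩, hv⟩ := exists_lt_of_csInf_lt hne
    (hc.symm.trans_lt (lt_add_of_pos_right cstarm hε))
  obtain ⟨heq, hcont, hpos, -⟩ := heig μ hμ
  have hlog : Real.log (lam μ) < (cstarm + ε) * μ := by
    rw [mul_comm]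
    exact (inv_mul_lt_iff₀ hμ.1).mp hv
  have hlam : lam μ < Real.exp ((cstarm + ε) * μ) := by
    rcases le_or_gt (lam μ) 0 with h | h
    · exact h.trans_lt (Real.exp_pos _)
    · exact (Real.log_lt_iff_lt_exp h).mp hlog
  have hsuper : funLE (Lp (efun (ofY (ζ μ)) (-μ)))
      (fun p i => Real.exp ((cstarm + ε) * μ) * efun (ofY (ζ μ)) (-μ) p i) := by
    rintro ⟨θ, x⟩ i
    rw [apply_efun_ofY_eq hlin hcomm hμ ⟨hcont, fun θ i => (hpos θ i).le⟩, heq]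
    have h := mul_le_mul_of_nonneg_right hlam.le
      (mul_pos (hpos θ i) (Real.exp_pos (μ * x))).le
    simp only [efun, ofY, neg_neg]
    linarith
  refine ⟨μ, hμ.1, hμ, ⟨hlam, ?_⟩, hsuper, fun n θ x i => ?_⟩
  · exact Real.exp_lt_one_iff.mpr (mul_neg_of_neg_of_pos (by linarith) hμ.1)
  · refine ((iterate_le_of_apply_le hlin (inCtilde_efun_ofY hcont _) (Real.exp_pos _).le
      hsuper n).2 (θ, x) i).trans_eq ?_
    simp only [efun, ofY, neg_neg]
    rw [← Real.exp_nat_mul, mul_comm (ζ μ θ i), ← mul_assoc, ← Real.exp_add]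
    ring_nf
end
end

section
/- Assume L̲₊ satisfies all conditions of Lemma 2.1 (in particular c*₋(L̲₊) < 0 and, for ε ∈ (0,−c*₋(L̲₊)), μ_ε > 0 is as produced by Lemma 2.1), and assume moreover L̲₊[φ] ≥ Q[φ] for all φ ∈ C_{φ₁*}. If W ∈ C_{φ₁*} satisfies Q[W] = W and limsup_{x→−∞} [ ||W(·,x)||_Y e^{−μ_ε x} ] < ∞ for some ε ∈ (0,−c*₋(L̲₊)), then W = 0. In other words, Q has no nontrivial fixed point W in C_{φ₁*} with limsup_{x→−∞} [ ||W(·,x)||_Y e^{−μ_ε x} ] < ∞ for some ε ∈ (0,−c*₋(L̲₊)). (Theorem 2.4) -/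
open Filter Topology

noncomputable section

/-- `e_{g,μ} ∈ C̃` for bounded `g`. -/
lemma inCtilde_efun {M : Type*} {N : ℕ} {g : Cfun M N} (hg : ∃ B, ∀ p i, |g p i| ≤ B) (μ : ℝ) :
    inCtilde (efun g μ) :=
  ⟨1, fun _ => g, fun _ => μ, fun _ => hg, by funext p i; simp [efun]⟩

lemma inCtilde_of_bounded {M : Type*} {N : ℕ} {g : Cfun M N} (hg : ∃ B, ∀ p i, |g p i| ≤ B) :
    inCtilde g := by
  convert inCtilde_efun hg 0 using 1
  funext p i
  simp [efun]

lemma inCtilde.const_mul {M : Type*} {N : ℕ} {φ : Cfun M N} (hφ : inCtilde φ) (a : ℝ) :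
    inCtilde (fun p i => a * φ p i) := by
  obtain ⟨l, g, μ, hg, rfl⟩ := hφ
  refine ⟨l, fun j p i => a * g j p i, μ, fun j => ?_, ?_⟩
  · obtain ⟨B, hB⟩ := hg j
    refine ⟨|a| * B, fun p i => ?_⟩
    rw [abs_mul]
    exact mul_le_mul_of_nonneg_left (hB p i) (abs_nonneg a)
  · funext p i
    simp only [Finset.mul_sum, mul_assoc]

lemma inCtilde.iterate {M : Type*} {N : ℕ} {L : Cfun M N → Cfun M N}
    (hL : LinearMonotoneOnCtilde L) {φ : Cfun M N} (hφ : inCtilde φ) (n : ℕ) :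
    inCtilde (L^[n] φ) := by
  induction n with
  | zero => exact hφ
  | succ n ih =>
    rw [Function.iterate_succ_apply']
    exact hL.1 _ ih

lemma abs_le_eNorm {N : ℕ} (a : Fin N → ℝ) (i : Fin N) : |a i| ≤ eNorm a :=
  Real.abs_le_sqrt
    (Finset.single_le_sum (f := fun j => a j ^ 2) (fun _ _ => sq_nonneg _) (Finset.mem_univ i))

lemma abs_le_normY {M : Type*} {N : ℕ} {g : M → Fin N → ℝ} (hg : ∃ B, ∀ θ i, |g θ i| ≤ B)
    (θ : M) (i : Fin N) : |g θ i| ≤ normY g := by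
  obtain ⟨B, hB⟩ := hg
  refine (abs_le_eNorm (g θ) i).trans (le_ciSup (f := fun θ => eNorm (g θ)) ?_ θ)
  refine ⟨Real.sqrt (∑ _i : Fin N, B ^ 2), ?_⟩
  rintro _ ⟨η, rfl⟩
  exact Real.sqrt_le_sqrt (Finset.sum_le_sum fun j _ => sq_le_sq' (abs_le.mp (hB η j)).1
    (abs_le.mp (hB η j)).2)

/-- A bounded function which is `O(e^{μx})` at `-∞`, with `μ ≥ 0`, is dominated by a multiple of
`e^{μx}` everywhere. -/
lemma exists_le_mul_exp {M : Type*} {N : ℕ} {W : Cfun M N} {μ : ℝ} (hμ : 0 ≤ μ)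
    (hW : ∃ B, ∀ p i, |W p i| ≤ B)
    (hdecay : ∃ A : ℝ, ∀ᶠ x : ℝ in atBot,
      normY (fun θ => W (θ, x)) * Real.exp (-μ * x) ≤ A) :
    ∃ K, 0 ≤ K ∧ ∀ p i, W p i ≤ K * Real.exp (μ * p.2) := by
  obtain ⟨B, hB⟩ := hW
  obtain ⟨A, hA⟩ := hdecay
  obtain ⟨x₀, hx₀⟩ := eventually_atBot.mp hA
  refine ⟨max 0 (max A (|B| * Real.exp (-μ * x₀))), le_max_left _ _, ?_⟩
  rintro ⟨θ, x⟩ i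
  have hexp := Real.exp_pos (μ * x)
  rcases le_total x x₀ with h | h
  · have hWN : W (θ, x) i ≤ normY (fun θ => W (θ, x)) :=
      (le_abs_self _).trans (abs_le_normY (g := fun θ => W (θ, x)) ⟨B, fun η j => hB _ j⟩ θ i)
    have hK : normY (fun θ => W (θ, x)) ≤ A * Real.exp (μ * x) := by
      have := mul_le_mul_of_nonneg_right (hx₀ x h) hexp.le
      rwa [mul_assoc, ← Real.exp_add, neg_mul, neg_add_cancel, Real.exp_zero, mul_one] at this
    exact (hWN.trans hK).trans
      (mul_le_mul_of_nonneg_right ((le_max_left _ _).trans (le_max_right _ _)) hexp.le)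
  · have hWB : W (θ, x) i ≤ |B| := ((le_abs_self _).trans (hB _ i)).trans (le_abs_self B)
    have hone : 1 ≤ Real.exp (-μ * x₀) * Real.exp (μ * x) := by
      rw [← Real.exp_add]
      exact Real.one_le_exp (by nlinarith)
    calc W (θ, x) i ≤ |B| * (Real.exp (-μ * x₀) * Real.exp (μ * x)) :=
          hWB.trans (le_mul_of_one_le_right (abs_nonneg B) hone)
      _ = |B| * Real.exp (-μ * x₀) * Real.exp (μ * x) := by ring
      _ ≤ _ := mul_le_mul_of_nonneg_right ((le_max_right _ _).trans (le_max_right _ _)) hexp.le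

/-- A subsolution `W ≤ L W` lying below `K φ` lies below `K Lⁿ φ` for every `n`. -/
lemma funLE_const_mul_iterate {M : Type*} {N : ℕ} {L : Cfun M N → Cfun M N}
    (hL : LinearMonotoneOnCtilde L) {W φ : Cfun M N} (hW : inCtilde W) (hφ : inCtilde φ)
    (hsub : funLE W (L W)) {K : ℝ} (hle : funLE W (fun p i => K * φ p i)) (n : ℕ) :
    funLE W (fun p i => K * L^[n] φ p i) := by
  induction n with
  | zero => exact hle
  | succ n ih =>
    have hn := inCtilde.iterate hL hφ n
    have h := hL.2.2.2 _ _ hW (hn.const_mul K) ih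
    rw [hL.2.2.1 K _ hn] at h
    rw [Function.iterate_succ_apply']
    exact fun p i => (hsub p i).trans (h p i)

/-- Theorem 2.4: assume `L̲₊` satisfies all conditions of Lemma 2.1 (so
`c*₋(L̲₊) < 0`, and for `ε ∈ (0,−c*₋(L̲₊))` the number `μ = μ_ε > 0` has the
properties produced by Lemma 2.1), and `L̲₊[φ] ≥ Q[φ]` on `C_{φ₁*}`.  If
`W ∈ C_{φ₁*}` with `Q[W] = W` and `limsup_{x→−∞} ‖W(·,x)‖_Y e^{−μ_ε x} < ∞` for some
`ε ∈ (0,−c*₋(L̲₊))`, then `W = 0`. -/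
theorem thm2_4 {M : Type*} {N : ℕ} [MetricSpace M] [CompactSpace M]
    (Q : Cfun M N → Cfun M N) (φk : ℕ → M → Fin N → ℝ)
    (Lp : Cfun M N → Cfun M N) (lam : ℝ → ℝ) (ζ : ℝ → M → Fin N → ℝ) (cstarm : ℝ)
    (hmaps : mapsCplus Q) (hcont : QContinuous Q) (hmono : QMonotone Q)
    (hUB : AssumptionUB Q φk)
    (hlin : LinearMonotoneOnCtilde Lp)
    (hcomm : CommutesWithTranslations Lp)
    (heig : EigenData Lp lam ζ)
    (hc : cstarm = sInf {v : ℝ | ∃ μ, inILm Lp μ ∧ v = μ⁻¹ * Real.log (lam μ)})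
    (hcneg : cstarm < 0)
    (hdom : ∀ φ, inCr (φk 1) φ → funLE (Q φ) (Lp φ))
    (W : Cfun M N) (hW : inCr (φk 1) W) (hfix : Q W = W)
    (ε μ : ℝ) (hε : 0 < ε) (hεlt : ε < -cstarm)
    -- `μ = μ_ε` as produced by Lemma 2.1:
    (hμpos : 0 < μ) (hμI : inILm Lp μ)
    (hμi : lam μ < Real.exp ((cstarm + ε) * μ) ∧ Real.exp ((cstarm + ε) * μ) < 1)
    (hμii : ∀ (n : ℕ) (θ : M) (x : ℝ) (i : Fin N),
      Lp^[n] (efun (ofY (ζ μ)) (-μ)) (θ, x) i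
        ≤ Real.exp ((x + n * (cstarm + ε)) * μ) * ζ μ θ i)
    -- `limsup_{x→−∞} ‖W(·,x)‖_Y e^{−μ x} < ∞`:
    (hbound : ∃ A : ℝ, ∀ᶠ x : ℝ in atBot,
      normY (fun θ => W (θ, x)) * Real.exp (-μ * x) ≤ A) :
    W = 0 := by
  obtain ⟨-, hζc, hζpos, hζinf⟩ := heig μ hμI
  have hζone : ∀ θ i, 1 ≤ ζ μ θ i := fun θ i => by
    rw [← hζinf]
    refine csInf_le ⟨0, ?_⟩ ⟨θ, i, rfl⟩
    rintro _ ⟨η, j, rfl⟩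
    exact (hζpos η j).le
  have hζbdd : ∃ B, ∀ p i, |ofY (ζ μ) p i| ≤ B := by
    obtain ⟨B, hB⟩ := isCompact_univ.exists_bound_of_continuousOn hζc.continuousOn
    exact ⟨B, fun p i => (norm_le_pi_norm (ζ μ p.1) i).trans (hB p.1 (Set.mem_univ _))⟩
  obtain ⟨K, hK, hWK⟩ := exists_le_mul_exp hμpos.le hW.1.2.1 hbound
  have hle : funLE W (fun p i => K * efun (ofY (ζ μ)) (-μ) p i) := fun p i => by
    refine (hWK p i).trans (mul_le_mul_of_nonneg_left ?_ hK)
    simp only [efun, ofY, neg_neg]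
    exact le_mul_of_one_le_left (Real.exp_pos _).le (hζone p.1 i)
  have hsub : funLE W (Lp W) := by
    have h := hdom W hW
    rwa [hfix] at h
  have hiter := funLE_const_mul_iterate hlin (inCtilde_of_bounded hW.1.2.1)
    (inCtilde_efun hζbdd (-μ)) hsub hle
  funext p i
  refine le_antisymm ?_ (hW.1.2.2 p i)
  obtain ⟨θ, x⟩ := p
  have hpow : Tendsto (fun n : ℕ => K * Real.exp (x * μ) * ζ μ θ i *
      Real.exp ((cstarm + ε) * μ) ^ n) atTop (𝓝 0) := by
    simpa using (tendsto_pow_atTop_nhds_zero_of_lt_one (Real.exp_pos _).le hμi.2).const_mul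
      (K * Real.exp (x * μ) * ζ μ θ i)
  refine ge_of_tendsto' hpow fun n => ?_
  calc W (θ, x) i ≤ K * Lp^[n] (efun (ofY (ζ μ)) (-μ)) (θ, x) i := hiter n (θ, x) i
    _ ≤ K * (Real.exp ((x + n * (cstarm + ε)) * μ) * ζ μ θ i) :=
        mul_le_mul_of_nonneg_left (hμii n θ x i) hK
    _ = _ := by
        rw [← Real.exp_nat_mul, add_mul, Real.exp_add, mul_assoc (n : ℝ)]
        ring
end
end

section
/- Let 𝔨 : ℝ → ℝ₊ be a nonnegative continuous kernel with ∫_ℝ 𝔨(y)dy = 1 and ∫_ℝ e^{μ₊y}𝔨(y)dy < ∞, ∫_ℝ e^{μ₋y}𝔨(y)dy < ∞ for some μ₊ > 0 > μ₋, let f satisfy (B1)–(B3), and define Q[φ;f](x) = ∫_ℝ f(x−y, φ(x−y))𝔨(y)dy for φ ∈ C₊. Then for every k ∈ ℕ: Q[C_{u_k*};f] ⊆ C_{u_k*}, and Q[C_{u_k*};f] is precompact in (C, ||·||) (i.e., its closure in the topology of ||·|| is compact). (Proposition, Section 4, part (i)) -/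
open Filter Topology MeasureTheory

noncomputable section

/-- The norm `‖φ‖ = ∑ₙ 2⁻ⁿ sup_{|x|≤n} |φ(x)|` of `C = BC(ℝ,ℝ)`
(inducing the topology of local uniform convergence). -/
def normloc (φ : ℝ → ℝ) : ℝ :=
  ∑' n : ℕ, (2 : ℝ)⁻¹ ^ (n + 1) * ⨆ x : {x : ℝ // |x| ≤ (n : ℝ) + 1}, |φ x.1|

/-- Membership in `C = BC(ℝ,ℝ)`. -/
def memBC (φ : ℝ → ℝ) : Prop := Continuous φ ∧ ∃ B, ∀ x, |φ x| ≤ B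

/-- Membership in `C₊ = BC(ℝ,ℝ₊)`. -/
def memBCpos (φ : ℝ → ℝ) : Prop := memBC φ ∧ ∀ x, 0 ≤ φ x

/-- Hypotheses on the dispersal kernel `𝔨`: nonnegative, continuous, total mass one,
with finite two-sided exponential moments. -/
structure KHyp (k : ℝ → ℝ) (μp μm : ℝ) : Prop where
  cont : Continuous k
  nonneg : ∀ x, 0 ≤ k x
  total : ∫ y, k y = 1
  mupPos : 0 < μp
  mumNeg : μm < 0
  intP : Integrable fun y => Real.exp (μp * y) * k y
  intM : Integrable fun y => Real.exp (μm * y) * k y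

/-- Hypotheses (B1)–(B3) on the nonlinearity `f`, with `fd = ∂ᵤf`, limiting
nonlinearities `fp = f₊`, `fm = f₋` (with derivatives `fpd`, `fmd`), the unique
positive fixed point `uplus = u₊*` of `f₊`, and the exhausting sequence `useq = uₖ*`. -/
structure FHyp (f fd : ℝ → ℝ → ℝ) (fp fm fpd fmd : ℝ → ℝ) (uplus : ℝ)
    (useq : ℕ → ℝ) : Prop where
  /- (B1) -/
  cont : ContinuousOn (fun p : ℝ × ℝ => f p.1 p.2) {p : ℝ × ℝ | 0 ≤ p.2}
  nonneg : ∀ s u, 0 ≤ u → 0 ≤ f s u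
  zero : ∀ s, f s 0 = 0
  pos : ∀ s u, 0 < u → 0 < f s u
  mono : ∀ s u v, 0 < u → u ≤ v → f s u ≤ f s v
  deriv : ∀ s u, 0 ≤ u → HasDerivWithinAt (f s) (fd s u) (Set.Ici 0) u
  derivCont : ∀ s, ContinuousOn (fd s) (Set.Ici 0)
  /- (B2): `f(s,·) → f_±` in `C¹_loc(ℝ₊,ℝ)` as `s → ±∞` -/
  derivP : ∀ u : ℝ, 0 ≤ u → HasDerivWithinAt fp (fpd u) (Set.Ici 0) u
  derivM : ∀ u : ℝ, 0 ≤ u → HasDerivWithinAt fm (fmd u) (Set.Ici 0) u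
  limP : ∀ b : ℝ, 0 < b →
    Tendsto (fun s => (⨆ u : Set.Icc (0 : ℝ) b, |f s u.1 - fp u.1|)
      + ⨆ u : Set.Icc (0 : ℝ) b, |fd s u.1 - fpd u.1|) atTop (nhds 0)
  limM : ∀ b : ℝ, 0 < b →
    Tendsto (fun s => (⨆ u : Set.Icc (0 : ℝ) b, |f s u.1 - fm u.1|)
      + ⨆ u : Set.Icc (0 : ℝ) b, |fd s u.1 - fmd u.1|) atBot (nhds 0)
  slopeP : 1 < fpd 0
  slopeM : fmd 0 < 1
  linP : ∀ u : ℝ, 0 ≤ u → 0 ≤ fp u ∧ fp u ≤ fpd 0 * u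
  linM : ∀ u : ℝ, 0 ≤ u → 0 ≤ fm u ∧ fm u ≤ fmd 0 * u
  ufixPos : 0 < uplus
  ufix : fp uplus = uplus
  ufixUniq : ∀ u : ℝ, 0 < u → fp u = u → u = uplus
  /- (B3) -/
  useqPos : ∀ k, 0 < useq k
  useqMono : StrictMono useq
  useqTop : Tendsto useq atTop atTop
  useqInv : ∀ k s u, 0 ≤ u → u ≤ useq k → f s u ≤ useq k

/-- The integro-difference operator `Q[φ;f](x) = ∫ f(x−y, φ(x−y)) 𝔨(y) dy`. -/
def Qmap (k : ℝ → ℝ) (f : ℝ → ℝ → ℝ) (φ : ℝ → ℝ) : ℝ → ℝ :=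
  fun x => ∫ y, f (x - y) (φ (x - y)) * k y

/-- `c* = inf_{μ>0} (1/μ) ln [ d ∫ e^{sgn·μy} 𝔨(y) dy ]`, the infimum being taken over
those `μ > 0` for which the integral is finite;  `cstar k d 1 = c*₊(∞)` and
`cstar k d (-1) = c*₋(∞)` for `d = f₊'(0)`. -/
def cstar (k : ℝ → ℝ) (d : ℝ) (sgn : ℝ) : ℝ :=
  sInf {c : ℝ | ∃ μ : ℝ, 0 < μ ∧ Integrable (fun y => Real.exp (sgn * μ * y) * k y) ∧
    c = μ⁻¹ * Real.log (d * ∫ y, Real.exp (sgn * μ * y) * k y)}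

/-- `C_r = {φ ∈ C₊ : φ ≤ r}`. -/
def memCr (r : ℝ) (φ : ℝ → ℝ) : Prop := memBCpos φ ∧ ∀ x, φ x ≤ r

/-- Sequential precompactness in `(C, ‖·‖)` (local uniform convergence). -/
def seqPrecompactBC (s : Set (ℝ → ℝ)) : Prop :=
  ∀ u : ℕ → ℝ → ℝ, (∀ n, u n ∈ s) → ∃ (g : ℝ → ℝ) (ι : ℕ → ℕ), StrictMono ι ∧
    Continuous g ∧ (∃ B, ∀ x, |g x| ≤ B) ∧
    Tendsto (fun n => normloc (fun x => u (ι n) x - g x)) atTop (nhds 0)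

/-- Translation is continuous at `0` in `L¹`, for nonnegative continuous integrable functions. -/
theorem tendsto_integral_abs_translate_sub {k : ℝ → ℝ} (hc : Continuous k)
    (h0 : ∀ x, 0 ≤ k x) (hi : Integrable k) :
    Tendsto (fun δ => ∫ y, |k (y + δ) - k y|) (𝓝 0) (𝓝 0) := by
  have hbound : ∀ δ y, ‖max (k y - k (y + δ)) 0‖ ≤ k y := fun δ y => by
    rw [Real.norm_of_nonneg (le_max_right _ _)]
    exact max_le (by linarith [h0 (y + δ)]) (h0 y)
  have hmeas : ∀ δ, AEStronglyMeasurable (fun y => max (k y - k (y + δ)) 0) volume := fun δ =>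
    Continuous.aestronglyMeasurable (by fun_prop)
  have hpart : ∀ δ, Integrable (fun y => max (k y - k (y + δ)) 0) := fun δ =>
    hi.mono' (hmeas δ) (Eventually.of_forall (hbound δ))
  have hshift : ∀ δ, Integrable (fun y => k (y + δ)) := fun δ => hi.comp_add_right δ
  have hscheffe : ∀ δ, ∫ y, |k (y + δ) - k y| = 2 * ∫ y, max (k y - k (y + δ)) 0 := fun δ => by
    have hpt : ∀ y, |k (y + δ) - k y| = 2 * max (k y - k (y + δ)) 0 + (k (y + δ) - k y) :=
      fun y => by
        rcases le_total (k y) (k (y + δ)) with h | h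
        · rw [abs_of_nonneg (by linarith), max_eq_right (by linarith)]; ring
        · rw [abs_of_nonpos (by linarith), max_eq_left (by linarith)]; ring
    have hdiff : Integrable fun y => k (y + δ) - k y := (hshift δ).sub hi
    simp_rw [hpt]
    rw [integral_add ((hpart δ).const_mul 2) hdiff, integral_const_mul,
      integral_sub (hshift δ) hi, integral_add_right_eq_self]
    ring
  have hlim : Tendsto (fun δ => ∫ y, max (k y - k (y + δ)) 0) (𝓝 0) (𝓝 (∫ _ : ℝ, (0 : ℝ))) := by
    refine tendsto_integral_filter_of_dominated_convergence k (Eventually.of_forall hmeas)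
      (Eventually.of_forall fun δ => Eventually.of_forall (hbound δ)) hi
      (Eventually.of_forall fun y => ?_)
    have hcont : Continuous fun δ => max (k y - k (y + δ)) 0 := by fun_prop
    simpa using hcont.tendsto 0
  simp_rw [hscheffe]
  simpa using hlim.const_mul 2

/-- Locally uniform convergence of a uniformly bounded sequence implies convergence
for `normloc`. -/
theorem tendsto_normloc_of_tendstoUniformlyOn {v : ℕ → ℝ → ℝ} {B : ℝ}
    (hB : ∀ n x, |v n x| ≤ B)
    (hv : ∀ K : Set ℝ, IsCompact K → TendstoUniformlyOn v (fun _ => 0) atTop K) :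
    Tendsto (fun n => normloc (v n)) atTop (𝓝 0) := by
  have hsum : Summable fun m : ℕ => (2 : ℝ)⁻¹ ^ (m + 1) * B :=
    (((summable_geometric_of_lt_one (by norm_num) (by norm_num)).comp_injective
      (add_left_injective 1)).mul_right B)
  have hne : ∀ m : ℕ, Nonempty {x : ℝ // |x| ≤ (m : ℝ) + 1} := fun m =>
    ⟨⟨0, by rw [abs_zero]; positivity⟩⟩
  have hnonneg : ∀ n (m : ℕ), 0 ≤ ⨆ x : {x : ℝ // |x| ≤ (m : ℝ) + 1}, |v n x.1| :=
    fun n m => Real.iSup_nonneg fun _ => abs_nonneg _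
  have hterm : ∀ m : ℕ, Tendsto
      (fun n => (2 : ℝ)⁻¹ ^ (m + 1) * ⨆ x : {x : ℝ // |x| ≤ (m : ℝ) + 1}, |v n x.1|)
      atTop (𝓝 0) := fun m => by
    suffices h : Tendsto (fun n => ⨆ x : {x : ℝ // |x| ≤ (m : ℝ) + 1}, |v n x.1|)
        atTop (𝓝 0) by simpa using h.const_mul ((2 : ℝ)⁻¹ ^ (m + 1))
    rw [Metric.tendsto_nhds]
    intro ε hε
    have hK := Metric.tendstoUniformlyOn_iff.1
      (hv (Set.Icc (-((m : ℝ) + 1)) ((m : ℝ) + 1)) isCompact_Icc) (ε / 2) (half_pos hε)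
    filter_upwards [hK] with n hn
    rw [Real.dist_eq, sub_zero, abs_of_nonneg (hnonneg n m)]
    have := hne m
    refine lt_of_le_of_lt (ciSup_le fun x => ?_) (half_lt_self hε)
    have hx := hn x.1 (abs_le.1 x.2)
    rw [Real.dist_eq, zero_sub, abs_neg] at hx
    exact hx.le
  have h := tendsto_tsum_of_dominated_convergence hsum hterm (Eventually.of_forall fun n m => by
    rw [Real.norm_of_nonneg (mul_nonneg (by positivity) (hnonneg n m))]
    have := hne m
    exact mul_le_mul_of_nonneg_left (ciSup_le fun x => hB n x) (by positivity))
  simpa [normloc] using h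

/-- A function with a modulus of continuity tending to `0` is continuous. -/
theorem continuous_of_modulus {g ω : ℝ → ℝ} (hω : Tendsto ω (𝓝 0) (𝓝 0))
    (hg : ∀ x y, |g x - g y| ≤ ω (x - y)) : Continuous g := by
  refine continuous_iff_continuousAt.2 fun x => tendsto_iff_dist_tendsto_zero.2
    (squeeze_zero (fun _ => dist_nonneg) (fun y => hg y x) (hω.comp ?_))
  simpa using (continuous_sub_right x).tendsto x

/-- Functions with values in `[0, M]` and a common modulus of continuity form a set
precompact for `normloc`. -/
theorem seqPrecompactBC_of_modulus {s : Set (ℝ → ℝ)} {M : ℝ} {ω : ℝ → ℝ}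
    (hω : Tendsto ω (𝓝 0) (𝓝 0)) (hs : ∀ g ∈ s, ∀ x, g x ∈ Set.Icc 0 M)
    (hmod : ∀ g ∈ s, ∀ x y, |g x - g y| ≤ ω (x - y)) : seqPrecompactBC s := by
  let P : Set (ℝ → ℝ) := {g | (∀ x, g x ∈ Set.Icc 0 M) ∧ ∀ x y, |g x - g y| ≤ ω (x - y)}
  have hωx : ∀ x, Tendsto (fun y => ω (x - y)) (𝓝 x) (𝓝 0) := fun x =>
    hω.comp (by simpa using (continuous_sub_left x).tendsto x)
  have hPcont : ∀ g ∈ P, Continuous g := fun g hg => continuous_of_modulus hω hg.2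
  have hPcompact : IsCompact P := by
    refine (isCompact_univ_pi fun _ : ℝ => isCompact_Icc (a := (0 : ℝ)) (b := M)).of_isClosed_subset
      ?_ fun g hg x _ => hg.1 x
    have hP : P = (⋂ x, {g | g x ∈ Set.Icc 0 M}) ∩ ⋂ x, ⋂ y, {g | |g x - g y| ≤ ω (x - y)} := by
      ext g; simp [P]
    rw [hP]
    refine (isClosed_iInter fun x => isClosed_Icc.preimage (continuous_apply x)).inter
      (isClosed_iInter fun x => isClosed_iInter fun y => isClosed_le ?_ continuous_const)
    fun_prop
  let S : Set C(ℝ, ℝ) := {g | (g : ℝ → ℝ) ∈ P}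
  have hSimage : ContinuousMap.toFun '' S = P := by
    ext g
    exact ⟨by rintro ⟨g, hg, rfl⟩; exact hg, fun hg => ⟨⟨g, hPcont g hg⟩, hg, rfl⟩⟩
  have hScompact : IsCompact S := by
    refine ArzelaAscoli.isCompact_of_equicontinuous S (hSimage ▸ hPcompact) fun x => ?_
    refine Metric.equicontinuousAt_of_continuity_modulus (fun y => ω (x - y)) (hωx x) _
      (Eventually.of_forall fun y g => ?_)
    rw [Real.dist_eq]
    exact g.2.2 x y
  intro u hu
  have huP : ∀ n, u n ∈ P := fun n => ⟨hs _ (hu n), hmod _ (hu n)⟩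
  obtain ⟨g, hgS, ι, hι, hlim⟩ := hScompact.isSeqCompact
    (x := fun n => (⟨u n, hPcont _ (huP n)⟩ : C(ℝ, ℝ))) huP
  have hg : ∀ x, g x ∈ Set.Icc 0 M := hgS.1
  refine ⟨g, ι, hι, g.continuous, ⟨M, fun x => ?_⟩, ?_⟩
  · rw [abs_of_nonneg (hg x).1]
    exact (hg x).2
  · refine tendsto_normloc_of_tendstoUniformlyOn (B := M) (fun n x => ?_) fun K hK => ?_
    · have h := (huP (ι n)).1 x
      exact abs_le.2 ⟨by linarith [h.1, (hg x).2], by linarith [h.2, (hg x).1]⟩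
    · have hunif := ContinuousMap.tendsto_iff_forall_isCompact_tendstoUniformlyOn.1 hlim K hK
      rw [Metric.tendstoUniformlyOn_iff] at hunif ⊢
      intro ε hε
      filter_upwards [hunif ε hε] with n hn x hx
      have h := hn x hx
      rw [dist_comm, Real.dist_eq] at h
      rw [dist_comm, Real.dist_eq, sub_zero]
      exact h

/-- Convolving a function with values in `[0, M]` with a probability density gives a function
with values in `[0, M]`. -/
theorem integral_mul_kernel_mem_Icc {k h : ℝ → ℝ} {M : ℝ} (h0 : ∀ x, 0 ≤ k x)
    (hi : Integrable k) (htot : ∫ y, k y = 1)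
    (hM : ∀ x, h x ∈ Set.Icc 0 M) (x : ℝ) : ∫ y, h (x - y) * k y ∈ Set.Icc 0 M := by
  refine ⟨integral_nonneg fun y => mul_nonneg (hM _).1 (h0 y), ?_⟩
  calc ∫ y, h (x - y) * k y ≤ ∫ y, M * k y :=
        integral_mono_of_nonneg (Eventually.of_forall fun y => mul_nonneg (hM _).1 (h0 y))
          (hi.const_mul M)
          (Eventually.of_forall fun y => mul_le_mul_of_nonneg_right (hM _).2 (h0 y))
    _ = M := by rw [integral_const_mul, htot, mul_one]

/-- The convolution of a kernel with a bounded continuous function inherits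
the `L¹` modulus of continuity of the kernel. -/
theorem abs_integral_mul_kernel_sub_le {k h : ℝ → ℝ} {M : ℝ} (hi : Integrable k)
    (hh : Continuous h) (hM : ∀ x, h x ∈ Set.Icc 0 M) (x x' : ℝ) :
    |(∫ y, h (x - y) * k y) - ∫ y, h (x' - y) * k y| ≤
      M * ∫ y, |k (y + (x - x')) - k y| := by
  have hnorm : ∀ z, ‖h z‖ ≤ M := fun z => by
    rw [Real.norm_of_nonneg (hM z).1]
    exact (hM z).2
  have hshift : ∀ c, Integrable fun y => k (y + c) := fun c => hi.comp_add_right c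
  have hint : ∀ c, Integrable fun y => h (x' - y) * k (y + c) := fun c =>
    (hshift c).bdd_mul (c := M) (by fun_prop) (Eventually.of_forall fun y => hnorm _)
  have hsub : ∫ y, h (x - y) * k y = ∫ y, h (x' - y) * k (y + (x - x')) := by
    rw [← integral_add_right_eq_self _ (x - x')]
    congr 1 with y
    congr 2
    ring
  have hint0 : Integrable fun y => h (x' - y) * k y := by simpa using hint 0
  rw [hsub, ← integral_sub (hint _) hint0, ← integral_const_mul, ← Real.norm_eq_abs]
  refine norm_integral_le_of_norm_le (((hshift _).sub hi).abs.const_mul M)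
    (Eventually.of_forall fun y => ?_)
  rw [← mul_sub, norm_mul, Real.norm_eq_abs (_ - _)]
  exact mul_le_mul_of_nonneg_right (hnorm _) (abs_nonneg _)

/-- Proposition (Section 4, part (i)): `Q[C_{uₖ*}; f] ⊆ C_{uₖ*}` and `Q[C_{uₖ*}; f]`
is precompact in `(C, ‖·‖)`, for every `k`. -/
theorem prop4_3_i (k : ℝ → ℝ) (μp μm : ℝ) (hk : KHyp k μp μm)
    (f fd : ℝ → ℝ → ℝ) (fp fm fpd fmd : ℝ → ℝ) (uplus : ℝ) (useq : ℕ → ℝ)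
    (hf : FHyp f fd fp fm fpd fmd uplus useq) (j : ℕ) :
    (∀ φ, memCr (useq j) φ → memCr (useq j) (Qmap k f φ)) ∧
      seqPrecompactBC (Qmap k f '' {φ | memCr (useq j) φ}) := by
  have hi : Integrable k := by
    by_contra h
    have htot := hk.total
    rw [integral_undef h] at htot
    exact zero_ne_one htot
  have hcont : ∀ φ, memCr (useq j) φ → Continuous fun s => f s (φ s) := fun φ hφ =>
    hf.cont.comp_continuous (continuous_id.prodMk hφ.1.1.1) hφ.1.2
  have hIcc : ∀ φ, memCr (useq j) φ → ∀ s, f s (φ s) ∈ Set.Icc 0 (useq j) := fun φ hφ s =>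
    ⟨hf.nonneg s _ (hφ.1.2 s), hf.useqInv j s _ (hφ.1.2 s) (hφ.2 s)⟩
  have hQ : ∀ φ, memCr (useq j) φ → ∀ x, Qmap k f φ x ∈ Set.Icc 0 (useq j) := fun φ hφ =>
    integral_mul_kernel_mem_Icc (h := fun s => f s (φ s)) hk.nonneg hi hk.total (hIcc φ hφ)
  have hmod : ∀ φ, memCr (useq j) φ → ∀ x x', |Qmap k f φ x - Qmap k f φ x'| ≤
      useq j * ∫ y, |k (y + (x - x')) - k y| := fun φ hφ =>
    abs_integral_mul_kernel_sub_le (h := fun s => f s (φ s)) hi (hcont φ hφ) (hIcc φ hφ)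
  have hω : Tendsto (fun δ => useq j * ∫ y, |k (y + δ) - k y|) (𝓝 0) (𝓝 0) := by
    simpa using (tendsto_integral_abs_translate_sub hk.cont hk.nonneg hi).const_mul (useq j)
  constructor
  · intro φ hφ
    have hQcont : Continuous (Qmap k f φ) :=
      continuous_of_modulus hω (hmod φ hφ)
    exact ⟨⟨⟨hQcont, useq j, fun x => by
      rw [abs_of_nonneg (hQ φ hφ x).1]
      exact (hQ φ hφ x).2⟩, fun x => (hQ φ hφ x).1⟩, fun x => (hQ φ hφ x).2⟩
  · refine seqPrecompactBC_of_modulus (M := useq j) hω ?_ ?_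
    · rintro _ ⟨φ, hφ, rfl⟩
      exact hQ φ hφ
    · rintro _ ⟨φ, hφ, rfl⟩
      exact hmod φ hφ
end
end

section
/- Let 𝔨 : ℝ → ℝ₊ be a nonnegative continuous kernel with ∫_ℝ 𝔨(y)dy = 1 and ∫_ℝ e^{μ₊y}𝔨(y)dy < ∞, ∫_ℝ e^{μ₋y}𝔨(y)dy < ∞ for some μ₊ > 0 > μ₋, and let d > 1. Define c*_± := inf_{μ>0} (1/μ)·ln[ d·∫_ℝ e^{±μy}𝔨(y)dy ] (with the convention that the infimum is taken over those μ ∈ (0,∞) for which the integral is finite). Then c*₊ + c*₋ > 0. (Proposition 4.4(i), the speed inequality with d = f₊'(0)) -/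
open Filter Topology MeasureTheory

noncomputable section

namespace KHyp

variable {k : ℝ → ℝ} {μp μm : ℝ}

lemma integrable (hk : KHyp k μp μm) : Integrable k := by
  by_contra h
  have := hk.total
  rw [integral_undef h] at this
  exact zero_ne_one this

lemma integrable_mul (hk : KHyp k μp μm) : Integrable fun y => y * k y := by
  have hp := hk.mupPos
  have hm : 0 < -μm := neg_pos.2 hk.mumNeg
  refine ((hk.intP.const_mul μp⁻¹).add (hk.intM.const_mul (-μm)⁻¹)).mono'
    (continuous_id.mul hk.cont).aestronglyMeasurable (ae_of_all _ fun y => ?_)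
  have h1 : y ≤ μp⁻¹ * Real.exp (μp * y) := by
    rw [le_inv_mul_iff₀ hp]
    linarith [Real.add_one_le_exp (μp * y)]
  have h2 : -y ≤ (-μm)⁻¹ * Real.exp (μm * y) := by
    rw [le_inv_mul_iff₀ hm]
    linarith [Real.add_one_le_exp (μm * y)]
  have h3 : 0 ≤ μp⁻¹ * Real.exp (μp * y) := by positivity
  have h4 : 0 ≤ (-μm)⁻¹ * Real.exp (μm * y) := by positivity
  have h5 : |y| ≤ μp⁻¹ * Real.exp (μp * y) + (-μm)⁻¹ * Real.exp (μm * y) :=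
    abs_le.2 ⟨by linarith, by linarith⟩
  calc ‖y * k y‖ = |y| * k y := by
        rw [norm_mul, Real.norm_eq_abs, Real.norm_eq_abs, abs_of_nonneg (hk.nonneg y)]
    _ ≤ (μp⁻¹ * Real.exp (μp * y) + (-μm)⁻¹ * Real.exp (μm * y)) * k y :=
        mul_le_mul_of_nonneg_right h5 (hk.nonneg y)
    _ = _ := by simp only [Pi.add_apply]; ring

/-- Jensen's inequality for the exponential. -/
lemma exp_mean_le (hk : KHyp k μp μm) {s : ℝ}
    (hs : Integrable fun y => Real.exp (s * y) * k y) :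
    Real.exp (s * ∫ y, y * k y) ≤ ∫ y, Real.exp (s * y) * k y := by
  set m := ∫ y, y * k y
  have hint : Integrable fun y =>
      Real.exp (s * m) * ((1 - s * m) * k y + s * (y * k y)) :=
    ((hk.integrable.const_mul _).add (hk.integrable_mul.const_mul _)).const_mul _
  have heq : ∫ y, Real.exp (s * m) * ((1 - s * m) * k y + s * (y * k y))
      = Real.exp (s * m) := by
    rw [integral_const_mul, integral_add (hk.integrable.const_mul _)
      (hk.integrable_mul.const_mul _), integral_const_mul, integral_const_mul, hk.total]
    change Real.exp (s * m) * ((1 - s * m) * 1 + s * m) = _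
    ring
  rw [← heq]
  refine integral_mono hint hs fun y => ?_
  have h : 1 - s * m + s * y ≤ Real.exp (s * y - s * m) := by
    linarith [Real.add_one_le_exp (s * y - s * m)]
  have h' : Real.exp (s * y) = Real.exp (s * m) * Real.exp (s * y - s * m) := by
    rw [← Real.exp_add]; ring_nf
  calc Real.exp (s * m) * ((1 - s * m) * k y + s * (y * k y))
      = Real.exp (s * m) * (1 - s * m + s * y) * k y := by ring
    _ ≤ Real.exp (s * m) * Real.exp (s * y - s * m) * k y :=
        mul_le_mul_of_nonneg_right
          (mul_le_mul_of_nonneg_left h (Real.exp_pos _).le) (hk.nonneg y)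
    _ = Real.exp (s * y) * k y := by rw [h']

/-- A continuous density is positive somewhere to the right of its mean. -/
lemma exists_pos_right_of_mean (hk : KHyp k μp μm) :
    ∃ y₀, (∫ y, y * k y) < y₀ ∧ 0 < k y₀ := by
  set m := ∫ y, y * k y with hm
  by_contra! h
  have hnn : ∀ y, 0 ≤ m * k y - y * k y := fun y => by
    rcases le_or_gt y m with hy | hy
    · nlinarith [hk.nonneg y]
    · simp [le_antisymm (h y hy) (hk.nonneg y)]
  have hint : Integrable fun y => m * k y - y * k y :=
    (hk.integrable.const_mul m).sub hk.integrable_mul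
  have h0 : ∫ y, (m * k y - y * k y) = 0 := by
    rw [integral_sub (hk.integrable.const_mul m) hk.integrable_mul, integral_const_mul,
      hk.total, ← hm]
    ring
  have hae := (integral_eq_zero_iff_of_nonneg hnn hint).1 h0
  have hk0 : k =ᵐ[volume] 0 := by
    filter_upwards [hae, Measure.ae_ne volume m] with y hy hne
    have : (m - y) * k y = 0 := by
      simp only [Pi.zero_apply] at hy
      linarith
    exact (mul_eq_zero.1 this).resolve_left (sub_ne_zero.2 hne.symm)
  have := hk.total
  rw [integral_congr_ae hk0] at this
  simp at this

/-- The exponential moments grow at least like `exp (μ a)` for some `a` beyond the mean. -/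
lemma exists_mul_exp_le (hk : KHyp k μp μm) :
    ∃ a p, (∫ y, y * k y) < a ∧ 0 < p ∧ ∀ μ, 0 < μ →
      (Integrable fun y => Real.exp (μ * y) * k y) →
      p * Real.exp (μ * a) ≤ ∫ y, Real.exp (μ * y) * k y := by
  obtain ⟨y₀, hy₀, hky₀⟩ := hk.exists_pos_right_of_mean
  obtain ⟨a, ha, hay₀⟩ := exists_between hy₀
  let w : ℝ → ℝ := fun y => max 0 (min (y - a) 1)
  have hw0 : ∀ y, 0 ≤ w y := fun y => le_max_left _ _
  have hw1 : ∀ y, w y ≤ 1 := fun y => max_le zero_le_one (min_le_right _ _)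
  have hwc : Continuous w := by fun_prop
  have hint : Integrable fun y => w y * k y := by
    refine hk.integrable.mono' (hwc.mul hk.cont).aestronglyMeasurable
      (ae_of_all _ fun y => ?_)
    rw [Real.norm_of_nonneg (mul_nonneg (hw0 y) (hk.nonneg y))]
    exact mul_le_of_le_one_left (hk.nonneg y) (hw1 y)
  have hwy₀ : 0 < w y₀ := lt_max_of_lt_right (lt_min (sub_pos.2 hay₀) one_pos)
  refine ⟨a, ∫ y, w y * k y, ha, ?_, fun μ hμ hi => ?_⟩
  · exact integral_pos_of_integrable_nonneg_nonzero (x := y₀) (hwc.mul hk.cont) hint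
      (fun y => mul_nonneg (hw0 y) (hk.nonneg y)) (mul_pos hwy₀ hky₀).ne'
  · rw [← integral_mul_const]
    refine integral_mono (hint.mul_const _) hi fun y => ?_
    have h : w y * Real.exp (μ * a) ≤ Real.exp (μ * y) := by
      rcases le_or_gt y a with hy | hy
      · have : w y = 0 := max_eq_left ((min_le_left _ _).trans (sub_nonpos.2 hy))
        rw [this, zero_mul]
        exact (Real.exp_pos _).le
      · exact (mul_le_of_le_one_left (Real.exp_pos _).le (hw1 y)).trans
          (Real.exp_le_exp.2 (mul_le_mul_of_nonneg_left hy.le hμ.le))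
    calc w y * k y * Real.exp (μ * a) = w y * Real.exp (μ * a) * k y := by ring
      _ ≤ Real.exp (μ * y) * k y := mul_le_mul_of_nonneg_right h (hk.nonneg y)

lemma neg_mean_le_cstar (hk : KHyp k μp μm) {d : ℝ} (hd : 1 < d) :
    -(∫ y, y * k y) ≤ cstar k d (-1) := by
  refine le_csInf ⟨_, -μm, neg_pos.2 hk.mumNeg, by simpa using hk.intM, rfl⟩ ?_
  rintro c ⟨μ, hμ, hi, rfl⟩
  have hJ := hk.exp_mean_le hi
  rw [le_inv_mul_iff₀ hμ, Real.le_log_iff_exp_le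
    (mul_pos (by linarith) ((Real.exp_pos _).trans_le hJ))]
  refine le_trans (le_of_eq_of_le (by ring_nf) hJ)
    (le_mul_of_one_le_left ((Real.exp_pos _).le.trans hJ) hd.le)

lemma mean_lt_cstar (hk : KHyp k μp μm) {d : ℝ} (hd : 1 < d) :
    (∫ y, y * k y) < cstar k d 1 := by
  obtain ⟨a, p, ha, hp, hap⟩ := hk.exists_mul_exp_le
  set m := ∫ y, y * k y with hm
  have hL : 0 < Real.log d := Real.log_pos hd
  have hd0 : 0 < d := by linarith
  have hden : 0 < Real.log d + |Real.log p| := by positivity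
  obtain ⟨t, ht0, ht1, ht⟩ : ∃ t, 0 < t ∧ t ≤ 1 ∧ 0 ≤ Real.log d + t * Real.log p := by
    refine ⟨Real.log d / (Real.log d + |Real.log p|), div_pos hL hden,
      (div_le_one hden).2 (by linarith [abs_nonneg (Real.log p)]), ?_⟩
    have : 0 ≤ Real.log d * (Real.log d + (|Real.log p| + Real.log p)) /
        (Real.log d + |Real.log p|) := by
      have := neg_abs_le (Real.log p)
      exact div_nonneg (mul_nonneg hL.le (by linarith)) hden.le
    convert this using 1
    field_simp
    ring
  have hlt : m < m + t * (a - m) := by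
    linarith [mul_pos ht0 (sub_pos.2 ha)]
  refine hlt.trans_le (le_csInf ⟨_, μp, hk.mupPos, by simpa using hk.intP, rfl⟩ ?_)
  rintro c ⟨μ, hμ, hi, rfl⟩
  simp only [one_mul] at hi ⊢
  have hJ := hk.exp_mean_le hi
  have hA := hap μ hμ hi
  have hM : 0 < ∫ y, Real.exp (μ * y) * k y := (Real.exp_pos _).trans_le hJ
  have h1 := (Real.le_log_iff_exp_le hM).2 hJ
  have h2 := Real.log_le_log (mul_pos hp (Real.exp_pos _)) hA
  rw [Real.log_mul hp.ne' (Real.exp_pos _).ne', Real.log_exp] at h2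
  rw [le_inv_mul_iff₀ hμ, Real.log_mul hd0.ne' hM.ne']
  rw [← hm] at h1
  nlinarith [mul_le_mul_of_nonneg_left h1 (sub_nonneg.2 ht1),
    mul_le_mul_of_nonneg_left h2 ht0.le]

end KHyp

/-- Proposition 4.4(i) (the speed inequality): if `𝔨` has finite two-sided exponential
moments and `d > 1`, then `c*₊ + c*₋ > 0`, where
`c*_± = inf_{μ>0} (1/μ) ln [ d ∫ e^{±μy} 𝔨(y) dy ]`. -/
theorem speed_sum_pos (k : ℝ → ℝ) (μp μm : ℝ) (hk : KHyp k μp μm)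
    (d : ℝ) (hd : 1 < d) :
    0 < cstar k d 1 + cstar k d (-1) := by
  linarith [hk.mean_lt_cstar hd, hk.neg_mean_le_cstar hd]
end
end
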